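/- Every concept C ∈ L(≥,⊓,⊤)[Σ_C,Σ_R] has a frontier F(C) w.r.t. L(≥,⊓,⊤)[Σ_C,Σ_R] whose total size satisfies Σ_{C' ∈ F(C)} |C'| ≤ 5 · (dp(C)+1) · |C|³. -/

import Mathlib

namespace DL

/-! ### Syntax of ALCQI concepts -/

/-- Roles: role names (indexed by ℕ) and inverse roles. -/
inductive Role where
  | name : ℕ → Role
  | inv  : ℕ → Role
deriving DecidableEq

/-- ALCQI concept expressions. -/
inductive Concept where
  | atom : ℕ → Concept
  | top  : Concept
  | bot  : Concept
  | and  : Concept → Concept → Concept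
  | or   : Concept → Concept → Concept
  | neg  : Concept → Concept
  | ex   : Role → Concept → Concept
  | all  : Role → Concept → Concept
  | atLeast : ℕ → Role → Concept → Concept
deriving DecidableEq

/-- The operators/constructors that a concept language may use. -/
inductive Op where
  | all | ex | ge | inv | and | or | top | bot | neg
deriving DecidableEq

/-! ### Interpretations and semantics -/

/-- An interpretation: a nonempty domain, interpretations of concept names
and of role names. -/
structure Interp where
  Δ : Type
  dom_nonempty : Nonempty Δ
  atom : ℕ → Set Δ
  rel : ℕ → Δ → Δ → Prop

def Role.sem (I : Interp) : Role → (I.Δ → I.Δ → Prop)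
  | .name R => I.rel R
  | .inv R  => fun d e => I.rel R e d

def Concept.sem (I : Interp) : Concept → Set I.Δ
  | .atom A => I.atom A
  | .top => Set.univ
  | .bot => ∅
  | .and C D => C.sem I ∩ D.sem I
  | .or C D => C.sem I ∪ D.sem I
  | .neg C => (C.sem I)ᶜ
  | .ex S C => {d | ∃ e, S.sem I d e ∧ e ∈ C.sem I}
  | .all S C => {d | ∀ e, S.sem I d e → e ∈ C.sem I}
  | .atLeast k S C => {d | ∃ s : Finset I.Δ, s.card = k ∧ ∀ e ∈ s, S.sem I d e ∧ e ∈ C.sem I}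

/-! ### Concept languages L(Os)[SC, SR] -/

def Role.inSig (Os : Finset Op) (SR : Finset ℕ) : Role → Prop
  | .name R => R ∈ SR
  | .inv R  => Op.inv ∈ Os ∧ R ∈ SR

/-- Membership of a concept in the language `L(Os)[SC, SR]`. -/
def Concept.inLang (Os : Finset Op) (SC SR : Finset ℕ) : Concept → Prop
  | .atom A => A ∈ SC
  | .top => Op.top ∈ Os
  | .bot => Op.bot ∈ Os
  | .and C D => Op.and ∈ Os ∧ C.inLang Os SC SR ∧ D.inLang Os SC SR
  | .or C D => Op.or ∈ Os ∧ C.inLang Os SC SR ∧ D.inLang Os SC SR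
  | .neg C => Op.neg ∈ Os ∧ C.inLang Os SC SR
  | .ex S C => Op.ex ∈ Os ∧ S.inSig Os SR ∧ C.inLang Os SC SR
  | .all S C => Op.all ∈ Os ∧ S.inSig Os SR ∧ C.inLang Os SC SR
  | .atLeast k S C => Op.ge ∈ Os ∧ 1 ≤ k ∧ S.inSig Os SR ∧ C.inLang Os SC SR

/-! ### DL-Lite ontologies -/

/-- Basic concepts: concept names, ∃R and ∃R⁻. -/
inductive Basic where
  | atom : ℕ → Basic
  | ex : Role → Basic
deriving DecidableEq

def Basic.sem (I : Interp) : Basic → Set I.Δ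
  | .atom A => I.atom A
  | .ex S => {d | ∃ e, S.sem I d e}

/-- A DL-Lite concept inclusion `B ⊑ C` where `C` is a basic concept
(`negated = false`) or a negated basic concept (`negated = true`). -/
structure CI where
  lhs : Basic
  rhs : Basic
  negated : Bool
deriving DecidableEq

def CI.sat (I : Interp) (ci : CI) : Prop :=
  if ci.negated then ci.lhs.sem I ⊆ (ci.rhs.sem I)ᶜ else ci.lhs.sem I ⊆ ci.rhs.sem I

/-- A DL-Lite ontology: a finite set (list) of concept inclusions. -/
abbrev Ontology := List CI

def Interp.satO (I : Interp) (Ont : Ontology) : Prop := ∀ ci ∈ Ont, ci.sat I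

/-! ### Pointed interpretations, examples, characterisations -/

structure PInterp where
  I : Interp
  pt : I.Δ

/-- A pointed interpretation is finite if its domain is finite. -/
def PInterp.finite (P : PInterp) : Prop := Finite P.I.Δ

/-- `C` fits a collection `(Epos, Eneg)` of labelled examples. -/
def Fits (C : Concept) (Epos Eneg : List PInterp) : Prop :=
  (∀ e ∈ Epos, e.pt ∈ C.sem e.I) ∧ (∀ e ∈ Eneg, e.pt ∉ C.sem e.I)

/-- Equivalence of concepts. -/
def CEquiv (C D : Concept) : Prop := ∀ I : Interp, C.sem I = D.sem I

/-- Equivalence of concepts relative to an ontology. -/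
def CEquivO (Ont : Ontology) (C D : Concept) : Prop :=
  ∀ I : Interp, I.satO Ont → C.sem I = D.sem I

/-- `⊨ C ⊑ D`. -/
def Subsumes (C D : Concept) : Prop := ∀ I : Interp, C.sem I ⊆ D.sem I

/-- `Ont ⊨ C ⊑ D`. -/
def SubsumesO (Ont : Ontology) (C D : Concept) : Prop :=
  ∀ I : Interp, I.satO Ont → C.sem I ⊆ D.sem I

/-- `(Epos, Eneg)` is a finite characterisation of `C` w.r.t. the
concept language (predicate) `L`: all examples are finite, `C` fits,
and every fitting concept of `L` is equivalent to `C`. -/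
def FinChar (L : Concept → Prop) (C : Concept) (Epos Eneg : List PInterp) : Prop :=
  (∀ e ∈ Epos ++ Eneg, e.finite) ∧
  Fits C Epos Eneg ∧
  ∀ D, L D → Fits D Epos Eneg → CEquiv C D

/-- Finite characterisation of `C` w.r.t. `L` under an ontology `Ont`:
all examples are finite and satisfy `Ont`, `C` fits, and every fitting
concept of `L` is equivalent to `C` relative to `Ont`. -/
def FinCharO (Ont : Ontology) (L : Concept → Prop) (C : Concept)
    (Epos Eneg : List PInterp) : Prop :=
  (∀ e ∈ Epos ++ Eneg, e.finite ∧ e.I.satO Ont) ∧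
  Fits C Epos Eneg ∧
  ∀ D, L D → Fits D Epos Eneg → CEquivO Ont C D

/-- `L(Os)` admits finite characterisations. -/
def AdmitsFinChar (Os : Finset Op) : Prop :=
  ∀ SC SR : Finset ℕ, ∀ C : Concept, C.inLang Os SC SR →
    ∃ Epos Eneg : List PInterp, FinChar (Concept.inLang Os SC SR) C Epos Eneg

/-- `L(Os)` admits finite characterisations under the ontology `Ont`. -/
def AdmitsFinCharO (Os : Finset Op) (Ont : Ontology) : Prop :=
  ∀ SC SR : Finset ℕ, ∀ C : Concept, C.inLang Os SC SR →
    ∃ Epos Eneg : List PInterp, FinCharO Ont (Concept.inLang Os SC SR) C Epos Eneg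

/-! ### Size, role depth, number restrictions -/

/-- Number of symbols of a concept expression (numbers in binary). -/
def Concept.size : Concept → ℕ
  | .atom _ => 1
  | .top => 1
  | .bot => 1
  | .and C D => C.size + D.size + 1
  | .or C D => C.size + D.size + 1
  | .neg C => C.size + 1
  | .ex _ C => C.size + 2
  | .all _ C => C.size + 2
  | .atLeast k _ C => C.size + 2 + Nat.size k

/-- Role depth of a concept. -/
def Concept.dp : Concept → ℕ
  | .atom _ => 0
  | .top => 0
  | .bot => 0
  | .and C D => max C.dp D.dp
  | .or C D => max C.dp D.dp
  | .neg C => C.dp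
  | .ex _ C => C.dp + 1
  | .all _ C => C.dp + 1
  | .atLeast _ _ C => C.dp + 1

/-- The largest number occurring in a number restriction of `C` (0 if none). -/
def Concept.nr : Concept → ℕ
  | .atom _ => 0
  | .top => 0
  | .bot => 0
  | .and C D => max C.nr D.nr
  | .or C D => max C.nr D.nr
  | .neg C => C.nr
  | .ex _ C => C.nr
  | .all _ C => C.nr
  | .atLeast k _ C => max k C.nr

/-- The operator set of `L(≥,⊓,⊤)`. -/
def ELQops : Finset Op := {Op.ge, Op.and, Op.top}

/-- `F` is a frontier for `C` w.r.t. the concept language `L`. -/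
def IsFrontier (L : Concept → Prop) (C : Concept) (F : List Concept) : Prop :=
  (∀ C' ∈ F, L C' ∧ Subsumes C C' ∧ ¬ Subsumes C' C) ∧
  (∀ D, L D → Subsumes C D → ¬ Subsumes D C → ∃ C' ∈ F, Subsumes C' D)

/-! ### Counting successors -/

theorem mem_atLeast_iff {I : Interp} {k : ℕ} {S : Role} {C : Concept} {d : I.Δ} :
    d ∈ (Concept.atLeast k S C).sem I ↔ (k : ℕ∞) ≤ {e | S.sem I d e ∧ e ∈ C.sem I}.encard := by
  constructor
  · rintro ⟨s, rfl, hs⟩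
    rw [← Set.encard_coe_eq_coe_finsetCard]
    exact Set.encard_le_encard fun e he => hs e he
  · intro h
    obtain ⟨t, ht, hk⟩ := Set.exists_subset_encard_eq h
    have hfin : t.Finite := Set.finite_of_encard_eq_coe hk
    refine ⟨hfin.toFinset, ?_, fun e he => ht (by simpa using he)⟩
    rw [hfin.encard_eq_coe_toFinset_card] at hk
    exact_mod_cast hk

theorem mem_atLeast_of_injective {I : Interp} {k : ℕ} {S : Role} {C : Concept} {d : I.Δ}
    (f : ℕ → I.Δ) (hf : Function.Injective f)
    (h : ∀ n < k, S.sem I d (f n) ∧ f n ∈ C.sem I) : d ∈ (Concept.atLeast k S C).sem I := by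
  refine ⟨(Finset.range k).map ⟨f, hf⟩, by simp, fun e he => ?_⟩
  obtain ⟨n, hn, rfl⟩ := Finset.mem_map.1 he
  exact h n (Finset.mem_range.1 hn)

theorem atLeast_mono {k k' : ℕ} {S : Role} {C D : Concept} (hk : k ≤ k') (h : Subsumes C D) :
    Subsumes (.atLeast k' S C) (.atLeast k S D) := by
  intro I d hd
  rw [mem_atLeast_iff] at hd ⊢
  refine le_trans (by exact_mod_cast hk) (hd.trans (Set.encard_le_encard ?_))
  exact fun e he => ⟨he.1, h I he.2⟩

/-! ### Interpretations used as countermodels -/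

/-- The interpretation on `ℕ` in which all names hold everywhere. -/
def fullInterp : Interp where
  Δ := ℕ
  dom_nonempty := ⟨0⟩
  atom _ := Set.univ
  rel _ _ _ := True

theorem mem_sem_fullInterp {SC SR : Finset ℕ} {C : Concept} (hC : C.inLang ELQops SC SR)
    (d : fullInterp.Δ) : d ∈ C.sem fullInterp := by
  induction C generalizing d with
  | atom A => exact Set.mem_univ d
  | top => exact Set.mem_univ d
  | and C D ihC ihD => exact ⟨ihC hC.2.1 d, ihD hC.2.2 d⟩
  | atLeast k S C ih =>
    refine mem_atLeast_of_injective (I := fullInterp) (fun n : ℕ => n) (fun _ _ h => h) fun n _ => ?_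
    exact ⟨by cases S <;> trivial, ih hC.2.2.2 _⟩
  | _ => simp [Concept.inLang, ELQops] at hC

/-- The disjoint union of the interpretations `(P i).I` together with a new root satisfying
the concept names in `names` and connected to the distinguished points as specified by `edge`. -/
def glue {ι : Type} (P : ι → PInterp) (names : Set ℕ) (edge : ℕ → ι → Prop) : Interp where
  Δ := Option (Σ i, (P i).I.Δ)
  dom_nonempty := ⟨none⟩
  atom A := {x | match x with
    | none => A ∈ names
    | some p => p.2 ∈ (P p.1).I.atom A}
  rel R x y := match x, y with
    | none, some q => edge R q.1 ∧ q.2 = (P q.1).pt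
    | some p, some q => ∃ b, q = ⟨p.1, b⟩ ∧ (P p.1).I.rel R p.2 b
    | _, none => False

theorem some_mem_sem_glue {SC SR : Finset ℕ} {C : Concept} (hC : C.inLang ELQops SC SR)
    {ι : Type} (P : ι → PInterp) (names : Set ℕ) (edge : ℕ → ι → Prop) (i : ι) (x : (P i).I.Δ) :
    (some ⟨i, x⟩ : (glue P names edge).Δ) ∈ C.sem (glue P names edge) ↔ x ∈ C.sem (P i).I := by
  induction C generalizing x with
  | atom A => exact Iff.rfl
  | top => exact Iff.rfl
  | and C D ihC ihD => exact and_congr (ihC hC.2.1 x) (ihD hC.2.2 x)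
  | atLeast k S C ih =>
    cases S with
    | inv r => simp [Concept.inLang, ELQops, Role.inSig] at hC
    | name r =>
      have hinj : Function.Injective
          (fun b => (some ⟨i, b⟩ : (glue P names edge).Δ)) := by
        intro a b h
        simpa using h
      have himage : {e | (Role.name r).sem (glue P names edge) (some ⟨i, x⟩) e ∧
            e ∈ C.sem (glue P names edge)} =
          (fun b => (some ⟨i, b⟩ : (glue P names edge).Δ)) ''
            {b | (Role.name r).sem (P i).I x b ∧ b ∈ C.sem (P i).I} := by
        ext e
        constructor
        · rintro ⟨hr, he⟩
          match e, hr, he with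
          | some q, ⟨b, hq, hb⟩, he =>
            subst hq
            exact ⟨b, ⟨hb, (ih hC.2.2.2 b).1 he⟩, rfl⟩
        · rintro ⟨b, ⟨hb, hbC⟩, rfl⟩
          exact ⟨⟨b, rfl, hb⟩, (ih hC.2.2.2 b).2 hbC⟩
      refine (mem_atLeast_iff (I := glue P names edge)).trans ?_
      rw [mem_atLeast_iff, himage]
      exact iff_of_eq (congrArg ((k : ℕ∞) ≤ ·) (hinj.encard_image _))
  | _ => simp [Concept.inLang, ELQops] at hC

/-- A point violating a given concept name and satisfying everything that does not mention it
at the root. -/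
theorem exists_not_mem_atom (SC SR : Finset ℕ) (A : ℕ) :
    ∃ (I : Interp) (d : I.Δ), d ∉ (Concept.atom A).sem I ∧
      (∀ B, B ≠ A → d ∈ (Concept.atom B).sem I) ∧
      ∀ k r C, C.inLang ELQops SC SR → d ∈ (Concept.atLeast k (.name r) C).sem I := by
  refine ⟨glue (fun _ : ℕ => ⟨fullInterp, (0 : ℕ)⟩) {B | B ≠ A} (fun _ _ => True), none,
    fun h => h rfl, fun B hB => hB, fun k r C hC => ?_⟩
  refine mem_atLeast_of_injective
    (I := glue (fun _ : ℕ => ⟨fullInterp, (0 : ℕ)⟩) {B | B ≠ A} (fun _ _ => True))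
    (fun n => some ⟨n, (0 : ℕ)⟩) (fun a b h => ?_) fun n _ => ⟨⟨trivial, rfl⟩, ?_⟩
  · exact congrArg Sigma.fst (Option.some.inj h)
  · exact (some_mem_sem_glue hC _ _ _ _ _).2 (mem_sem_fullInterp hC _)

/-- A point violating `≥ k r.D` and satisfying every concept name and every number restriction
that is not syntactically at least as strong as `≥ k r.D`. -/
theorem exists_not_mem_atLeast (SC SR : Finset ℕ) {k : ℕ} (hk : 1 ≤ k) (r : ℕ) {D : Concept}
    (hD : D.inLang ELQops SC SR) :
    ∃ (I : Interp) (d : I.Δ), d ∉ (Concept.atLeast k (.name r) D).sem I ∧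
      (∀ B, d ∈ (Concept.atom B).sem I) ∧
      ∀ k' r' D', D'.inLang ELQops SC SR → (r' = r → k ≤ k' → ¬ Subsumes D' D) →
        d ∈ (Concept.atLeast k' (.name r') D').sem I := by
  have hcounter : ∀ p : {E : Concept // ¬ Subsumes E D},
      ∃ Q : PInterp, Q.pt ∈ p.1.sem Q.I ∧ Q.pt ∉ D.sem Q.I := by
    rintro ⟨E, hE⟩
    simp only [Subsumes, not_forall, Set.not_subset] at hE
    obtain ⟨I, d, hd⟩ := hE
    exact ⟨⟨I, d⟩, hd⟩
  choose Q hQ hQD using hcounter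
  let P : ℕ ⊕ ({E : Concept // ¬ Subsumes E D} × ℕ) → PInterp :=
    Sum.elim (fun _ => ⟨fullInterp, (0 : ℕ)⟩) (fun p => Q p.1)
  let edge : ℕ → ℕ ⊕ ({E : Concept // ¬ Subsumes E D} × ℕ) → Prop := fun r' =>
    Sum.elim (fun n => r' = r → n + 1 < k) (fun _ => True)
  refine ⟨glue P Set.univ edge, none, ?_, fun B => Set.mem_univ B, ?_⟩
  · refine fun hmem => absurd ((mem_atLeast_iff (I := glue P Set.univ edge)).1 hmem) (not_le.2 ?_)
    have hsub : {e | (Role.name r).sem (glue P Set.univ edge) none e ∧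
          e ∈ D.sem (glue P Set.univ edge)} ⊆
        (fun n => (some ⟨Sum.inl n, (0 : ℕ)⟩ : (glue P Set.univ edge).Δ)) ''
          (Finset.range (k - 1) : Set ℕ) := by
      rintro e ⟨hr, he⟩
      match e, hr, he with
      | some ⟨.inl n, x⟩, ⟨hn, hx⟩, _ =>
        have hn' : n + 1 < k := hn rfl
        refine ⟨n, by simp; omega, ?_⟩
        have hx' : x = (0 : ℕ) := hx
        rw [hx']
      | some ⟨.inr p, x⟩, ⟨_, hx⟩, he =>
        have hx' : x = (Q p.1).pt := hx
        rw [hx'] at he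
        exact absurd ((some_mem_sem_glue hD P Set.univ edge (.inr p) _).1 he) (hQD p.1)
    refine lt_of_le_of_lt ((Set.encard_le_encard hsub).trans (Set.encard_image_le _ _)) ?_
    rw [Set.encard_coe_eq_coe_finsetCard, Finset.card_range]
    exact_mod_cast (by omega : k - 1 < k)
  · intro k' r' D' hD' h
    by_cases hs : r' = r ∧ k ≤ k'
    · have hE := h hs.1 hs.2
      refine mem_atLeast_of_injective (I := glue P Set.univ edge)
        (fun n => some ⟨.inr (⟨D', hE⟩, n), (Q ⟨D', hE⟩).pt⟩) (fun a b hab => ?_)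
        fun n _ => ⟨⟨trivial, rfl⟩, ?_⟩
      · have := congrArg Sigma.fst (Option.some.inj hab)
        simpa using this
      · exact (some_mem_sem_glue hD' P Set.univ edge _ _).2 (hQ ⟨D', hE⟩)
    · refine mem_atLeast_of_injective (I := glue P Set.univ edge)
        (fun n => some ⟨.inl n, (0 : ℕ)⟩) (fun a b hab => ?_)
        fun n hn => ⟨⟨fun hr => ?_, rfl⟩, ?_⟩
      · have := congrArg Sigma.fst (Option.some.inj hab)
        simpa using this
      · have : ¬ k ≤ k' := fun hk' => hs ⟨hr, hk'⟩
        omega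
      · exact (some_mem_sem_glue hD' P Set.univ edge _ _).2 (mem_sem_fullInterp hD' _)

theorem subsumes_atLeast_iff {SC SR : Finset ℕ} {k k' r r' : ℕ} {D D' : Concept} (hk : 1 ≤ k)
    (hD : D.inLang ELQops SC SR) (hD' : D'.inLang ELQops SC SR) :
    Subsumes (.atLeast k' (.name r') D') (.atLeast k (.name r) D) ↔
      r' = r ∧ k ≤ k' ∧ Subsumes D' D := by
  constructor
  · intro h
    by_contra hcon
    obtain ⟨I, d, hd, -, hall⟩ := exists_not_mem_atLeast SC SR hk r hD
    exact hd (h I (hall k' r' D' hD' fun hr hk' hs => hcon ⟨hr, hk', hs⟩))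
  · rintro ⟨rfl, hle, hs⟩
    exact atLeast_mono hle hs

/-! ### Conjunctions of concept names and number restrictions -/

/-- Concept names and number restrictions of `L(≥,⊓,⊤)[SC,SR]`. -/
def IsConjunct (SC SR : Finset ℕ) (c : Concept) : Prop :=
  (∃ A ∈ SC, c = .atom A) ∨
    ∃ k r D, 1 ≤ k ∧ r ∈ SR ∧ D.inLang ELQops SC SR ∧ c = .atLeast k (.name r) D

theorem IsConjunct.inLang {SC SR : Finset ℕ} {c : Concept} (hc : IsConjunct SC SR c) :
    c.inLang ELQops SC SR := by
  obtain ⟨A, hA, rfl⟩ | ⟨k, r, D, hk, hr, hD, rfl⟩ := hc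
  · exact hA
  · exact ⟨by simp [ELQops], hk, hr, hD⟩

/-- Concept names and number restrictions are prime with respect to conjunction. -/
theorem IsConjunct.exists_subsumes {SC SR : Finset ℕ} {e : Concept} (he : IsConjunct SC SR e)
    {s : Set Concept} (hs : ∀ c ∈ s, IsConjunct SC SR c)
    (h : ∀ (I : Interp) (d : I.Δ), (∀ c ∈ s, d ∈ c.sem I) → d ∈ e.sem I) :
    ∃ c ∈ s, Subsumes c e := by
  by_contra! hcon
  obtain ⟨A, hA, rfl⟩ | ⟨k, r, D, hk, hr, hD, rfl⟩ := he
  · obtain ⟨I, d, hd, hatom, hall⟩ := exists_not_mem_atom SC SR A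
    refine hd (h I d fun c hc => ?_)
    obtain ⟨B, hB, rfl⟩ | ⟨k', r', D', hk', hr', hD', rfl⟩ := hs c hc
    · refine hatom B fun hBA => hcon _ hc ?_
      rw [hBA]
      exact fun _ => subset_rfl
    · exact hall k' r' D' hD'
  · obtain ⟨I, d, hd, hatom, hall⟩ := exists_not_mem_atLeast SC SR hk r hD
    refine hd (h I d fun c hc => ?_)
    obtain ⟨B, hB, rfl⟩ | ⟨k', r', D', hk', hr', hD', rfl⟩ := hs c hc
    · exact hatom B
    · exact hall k' r' D' hD' fun hrr hkk hsub =>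
        hcon _ hc ((subsumes_atLeast_iff hk hD hD').2 ⟨hrr, hkk, hsub⟩)

/-- The conjunction of a list of concepts. -/
def bigAnd : List Concept → Concept
  | [] => .top
  | c :: l => .and c (bigAnd l)

theorem mem_sem_bigAnd {I : Interp} {d : I.Δ} {l : List Concept} :
    d ∈ (bigAnd l).sem I ↔ ∀ c ∈ l, d ∈ c.sem I := by
  induction l with
  | nil => simp [bigAnd, Concept.sem]
  | cons c l ih => simp [bigAnd, Concept.sem, ih]

theorem bigAnd_inLang {SC SR : Finset ℕ} {l : List Concept}
    (h : ∀ c ∈ l, c.inLang ELQops SC SR) : (bigAnd l).inLang ELQops SC SR := by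
  induction l with
  | nil => simp [bigAnd, Concept.inLang, ELQops]
  | cons c l ih =>
    exact ⟨by simp [ELQops], h c (by simp), ih fun c' hc' => h c' (by simp [hc'])⟩

theorem size_bigAnd (l : List Concept) :
    (bigAnd l).size = (l.map fun c => c.size + 1).sum + 1 := by
  induction l with
  | nil => rfl
  | cons c l ih => simp [bigAnd, Concept.size, ih]; ring

/-- The top-level conjuncts of a concept, not counting `⊤`. -/
def conjuncts : Concept → Finset Concept
  | .top => ∅
  | .and C D => conjuncts C ∪ conjuncts D
  | C => {C}

theorem mem_sem_iff_conjuncts (C : Concept) (I : Interp) (d : I.Δ) :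
    d ∈ C.sem I ↔ ∀ c ∈ conjuncts C, d ∈ c.sem I := by
  induction C with
  | top => simp [conjuncts, Concept.sem]
  | and C D ihC ihD =>
    simp only [Concept.sem, Set.mem_inter_iff, ihC, ihD, conjuncts, Finset.mem_union]
    exact ⟨fun h c hc => hc.elim (h.1 c) (h.2 c), fun h => ⟨fun c hc => h c (.inl hc),
      fun c hc => h c (.inr hc)⟩⟩
  | _ => simp [conjuncts]

theorem isConjunct_of_mem_conjuncts {SC SR : Finset ℕ} {C c : Concept}
    (hC : C.inLang ELQops SC SR) (hc : c ∈ conjuncts C) : IsConjunct SC SR c := by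
  induction C with
  | atom A =>
    simp only [conjuncts, Finset.mem_singleton] at hc
    exact .inl ⟨A, hC, hc⟩
  | top => simp [conjuncts] at hc
  | and C D ihC ihD =>
    exact (Finset.mem_union.1 hc).elim (ihC hC.2.1) (ihD hC.2.2)
  | atLeast k S C ih =>
    simp only [conjuncts, Finset.mem_singleton] at hc
    cases S with
    | inv r => simp [Concept.inLang, ELQops, Role.inSig] at hC
    | name r => exact .inr ⟨k, r, C, hC.2.1, hC.2.2.1, hC.2.2.2, hc⟩
  | _ => simp [Concept.inLang, ELQops] at hC

theorem dp_le_of_mem_conjuncts {C c : Concept} (hc : c ∈ conjuncts C) : c.dp ≤ C.dp := by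
  induction C with
  | top => simp [conjuncts] at hc
  | and C D ihC ihD =>
    exact (Finset.mem_union.1 hc).elim (fun h => (ihC h).trans (le_max_left _ _))
      (fun h => (ihD h).trans (le_max_right _ _))
  | _ =>
    simp only [conjuncts, Finset.mem_singleton] at hc
    rw [hc]

theorem Concept.size_pos (C : Concept) : 1 ≤ C.size := by
  cases C <;> (simp only [Concept.size]; omega)

theorem sum_union_le_add {α : Type*} [DecidableEq α] (s t : Finset α) (f : α → ℕ) :
    ∑ x ∈ s ∪ t, f x ≤ ∑ x ∈ s, f x + ∑ x ∈ t, f x := by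
  rw [← Finset.sum_union_inter]
  exact Nat.le_add_right _ _

theorem sum_conjuncts_size_succ_le (C : Concept) :
    ∑ c ∈ conjuncts C, (c.size + 1) ≤ C.size + 1 := by
  induction C with
  | top => simp [conjuncts]
  | and C D ihC ihD =>
    refine (sum_union_le_add _ _ _).trans ?_
    simp only [Concept.size]
    omega
  | _ => simp [conjuncts]

theorem sum_conjuncts_size_le (C : Concept) : ∑ c ∈ conjuncts C, c.size ≤ C.size := by
  induction C with
  | top => simp [conjuncts]
  | and C D ihC ihD =>
    refine (sum_union_le_add _ _ _).trans ?_
    simp only [Concept.size]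
    omega
  | _ => simp [conjuncts]

/-! ### The frontier -/

/-- `w` is a frontier for the conjunct `c` among concept names and number restrictions. -/
structure IsConjunctFrontier (SC SR : Finset ℕ) (c : Concept) (w : List Concept) : Prop where
  isConjunct : ∀ x ∈ w, IsConjunct SC SR x
  subsumes : ∀ x ∈ w, Subsumes c x
  not_subsumes : ∀ x ∈ w, ¬ Subsumes x c
  exists_subsumes : ∀ e, IsConjunct SC SR e → Subsumes c e → ¬ Subsumes e c →
    ∃ x ∈ w, Subsumes x e

theorem isConjunctFrontier_atom (SC SR : Finset ℕ) (A : ℕ) :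
    IsConjunctFrontier SC SR (.atom A) [] := by
  refine ⟨by simp, by simp, by simp, fun e he hsub hnot => ?_⟩
  exfalso
  obtain ⟨B, hB, rfl⟩ | ⟨k, r, D, hk, hr, hD, rfl⟩ := he
  · by_cases hBA : A = B
    · exact hnot (hBA ▸ fun _ => subset_rfl)
    · obtain ⟨I, d, hd, hatom, -⟩ := exists_not_mem_atom SC SR B
      exact hd (hsub I (hatom A hBA))
  · obtain ⟨I, d, hd, hatom, -⟩ := exists_not_mem_atLeast SC SR hk r hD
    exact hd (hsub I (hatom A))

/-- The minimal weakenings of `≥ k r.D`, given a frontier `F` for `D`. -/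
def weakenings (k r : ℕ) (D : Concept) (F : List Concept) : List Concept :=
  (if 2 ≤ k then [.atLeast (k - 1) (.name r) D] else []) ++ F.map (.atLeast k (.name r))

theorem mem_weakenings {k r : ℕ} {D x : Concept} {F : List Concept} :
    x ∈ weakenings k r D F ↔
      (2 ≤ k ∧ x = .atLeast (k - 1) (.name r) D) ∨ ∃ D' ∈ F, x = .atLeast k (.name r) D' := by
  unfold weakenings
  split_ifs with h <;> simp [h, eq_comm]

theorem isConjunctFrontier_weakenings {SC SR : Finset ℕ} {k r : ℕ} {D : Concept}
    {F : List Concept} (hk : 1 ≤ k) (hr : r ∈ SR) (hD : D.inLang ELQops SC SR)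
    (hF : IsFrontier (Concept.inLang ELQops SC SR) D F) :
    IsConjunctFrontier SC SR (.atLeast k (.name r) D) (weakenings k r D F) where
  isConjunct x hx := by
    obtain ⟨h2, rfl⟩ | ⟨D', hD', rfl⟩ := mem_weakenings.1 hx
    · exact .inr ⟨_, _, _, by omega, hr, hD, rfl⟩
    · exact .inr ⟨_, _, _, hk, hr, (hF.1 D' hD').1, rfl⟩
  subsumes x hx := by
    obtain ⟨h2, rfl⟩ | ⟨D', hD', rfl⟩ := mem_weakenings.1 hx
    · exact atLeast_mono (Nat.sub_le _ _) fun _ => subset_rfl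
    · exact atLeast_mono le_rfl (hF.1 D' hD').2.1
  not_subsumes x hx h := by
    obtain ⟨h2, rfl⟩ | ⟨D', hD', rfl⟩ := mem_weakenings.1 hx
    · have := ((subsumes_atLeast_iff hk hD hD).1 h).2.1
      omega
    · exact (hF.1 D' hD').2.2 ((subsumes_atLeast_iff hk hD (hF.1 D' hD').1).1 h).2.2
  exists_subsumes e he hsub hnot := by
    obtain ⟨B, hB, rfl⟩ | ⟨k', r', D', hk', hr', hD', rfl⟩ := he
    · obtain ⟨I, d, hd, -, hall⟩ := exists_not_mem_atom SC SR B
      exact absurd (hsub I (hall k r D hD)) hd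
    · obtain ⟨rfl, hkk, hDD⟩ := (subsumes_atLeast_iff hk' hD' hD).1 hsub
      rcases hkk.lt_or_eq with hlt | rfl
      · exact ⟨_, mem_weakenings.2 (.inl ⟨by omega, rfl⟩), atLeast_mono (by omega) hDD⟩
      · have hstrict : ¬ Subsumes D' D := fun h => hnot (atLeast_mono le_rfl h)
        obtain ⟨E, hE, hED⟩ := hF.2 D' hD' hDD hstrict
        exact ⟨_, mem_weakenings.2 (.inr ⟨E, hE, rfl⟩), atLeast_mono le_rfl hED⟩

theorem sum_size_weakenings_le (k r : ℕ) (D : Concept) (F : List Concept) :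
    ((weakenings k r D F).map fun x => x.size + 1).sum ≤
      (D.size + Nat.size k + 3) + (F.map Concept.size).sum + F.length * (Nat.size k + 3) := by
  have hsize : Nat.size (k - 1) ≤ Nat.size k := Nat.size_le_size (Nat.sub_le _ _)
  have hF : ((F.map (Concept.atLeast k (.name r))).map fun x => x.size + 1).sum =
      (F.map Concept.size).sum + F.length * (Nat.size k + 3) := by
    induction F with
    | nil => simp
    | cons E F ih =>
      simp only [List.map_cons, List.sum_cons, ih, List.length_cons, Concept.size]
      ring
  rw [weakenings, List.map_append, List.sum_append, hF]
  split_ifs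
  · simp [Concept.size]
    omega
  · simp

/-- Replacing, in an irredundant set of conjuncts for `C`, one conjunct at a time by a frontier
for it yields a frontier for `C`. -/
theorem isFrontier_of_irredundant {SC SR : Finset ℕ} {C : Concept} {s : Finset Concept}
    {w : Concept → List Concept} (hs : ∀ c ∈ s, IsConjunct SC SR c)
    (hsC : ∀ (I : Interp) (d : I.Δ), d ∈ C.sem I ↔ ∀ c ∈ s, d ∈ c.sem I)
    (hirr : ∀ c ∈ s, ∀ x ∈ s.erase c, ¬ Subsumes x c)
    (hw : ∀ c ∈ s, IsConjunctFrontier SC SR c (w c)) :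
    IsFrontier (Concept.inLang ELQops SC SR) C
      (s.toList.map fun c => bigAnd (w c ++ (s.erase c).toList)) := by
  constructor
  · intro C' hC'
    obtain ⟨c, hc, rfl⟩ := List.mem_map.1 hC'
    rw [Finset.mem_toList] at hc
    have hconj : ∀ x ∈ w c ++ (s.erase c).toList, IsConjunct SC SR x := by
      intro x hx
      rcases List.mem_append.1 hx with hx | hx
      · exact (hw c hc).isConjunct x hx
      · exact hs x (Finset.mem_of_mem_erase (Finset.mem_toList.1 hx))
    refine ⟨bigAnd_inLang fun x hx => (hconj x hx).inLang, fun I d hd => ?_, fun hsub => ?_⟩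
    · rw [hsC] at hd
      refine mem_sem_bigAnd.2 fun x hx => ?_
      rcases List.mem_append.1 hx with hx | hx
      · exact (hw c hc).subsumes x hx I (hd c hc)
      · exact hd x (Finset.mem_of_mem_erase (Finset.mem_toList.1 hx))
    · obtain ⟨x, hx, hxc⟩ := (hs c hc).exists_subsumes
        (s := {x | x ∈ w c ++ (s.erase c).toList}) hconj
        fun I d hd => (hsC I d).1 (hsub I (mem_sem_bigAnd.2 hd)) c hc
      rcases List.mem_append.1 hx with hx | hx
      · exact (hw c hc).not_subsumes x hx hxc
      · exact hirr c hc x (Finset.mem_toList.1 hx) hxc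
  · intro D hD hCD hDC
    obtain ⟨c, hc, hDc⟩ : ∃ c ∈ s, ¬ Subsumes D c := by
      by_contra! h
      exact hDC fun I d hd => (hsC I d).2 fun c hc => h c hc I hd
    refine ⟨_, List.mem_map.2 ⟨c, Finset.mem_toList.2 hc, rfl⟩, fun I d hd => ?_⟩
    rw [mem_sem_bigAnd] at hd
    refine (mem_sem_iff_conjuncts D I d).2 fun e he => ?_
    have heconj := isConjunct_of_mem_conjuncts hD he
    have hDe : Subsumes D e := fun J x hx => (mem_sem_iff_conjuncts D J x).1 hx e he
    obtain ⟨x, hx, hxe⟩ := heconj.exists_subsumes (s := (s : Set Concept)) hs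
      fun J y hy => hDe J (hCD J ((hsC J y).2 hy))
    by_cases hxc : x = c
    · subst hxc
      obtain ⟨y, hy, hye⟩ := (hw x hx).exists_subsumes e heconj hxe
        fun hex => hDc fun J z hz => hex J (hDe J hz)
      exact hye I (hd y (List.mem_append.2 (.inl hy)))
    · exact hxe I (hd x (List.mem_append.2
        (.inr (Finset.mem_toList.2 (Finset.mem_erase.2 ⟨hxc, hx⟩)))))

theorem exists_irredundant_conjuncts (C : Concept) :
    ∃ s ⊆ conjuncts C, (∀ (I : Interp) (d : I.Δ), d ∈ C.sem I ↔ ∀ c ∈ s, d ∈ c.sem I) ∧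
      ∀ c ∈ s, ∀ x ∈ s.erase c, ¬ Subsumes x c := by
  classical
  let T := (conjuncts C).powerset.filter
    fun s => ∀ (I : Interp) (d : I.Δ), d ∈ C.sem I ↔ ∀ c ∈ s, d ∈ c.sem I
  have hT : T.Nonempty := ⟨conjuncts C, by simpa [T] using mem_sem_iff_conjuncts C⟩
  obtain ⟨s, hsT, hmin⟩ := T.exists_min_image Finset.card hT
  obtain ⟨hsub, hsC⟩ := Finset.mem_filter.1 hsT
  rw [Finset.mem_powerset] at hsub
  refine ⟨s, hsub, hsC, fun c hc x hx hxc => ?_⟩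
  have herase : s.erase c ∈ T := by
    refine Finset.mem_filter.2
      ⟨Finset.mem_powerset.2 ((Finset.erase_subset _ _).trans hsub), fun I d => ?_⟩
    rw [hsC]
    refine ⟨fun h y hy => h y (Finset.mem_of_mem_erase hy), fun h y hy => ?_⟩
    by_cases hyc : y = c
    · exact hyc ▸ hxc I (h x hx)
    · exact h y (Finset.mem_erase.2 ⟨hyc, hy⟩)
  exact absurd (hmin _ herase) (Finset.card_erase_lt_of_mem hc).not_ge

theorem exists_frontier (SC SR : Finset ℕ) (C : Concept) (hC : C.inLang ELQops SC SR) :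
    ∃ F : List Concept, IsFrontier (Concept.inLang ELQops SC SR) C F ∧ F.length ≤ C.size ∧
      (F.map Concept.size).sum ≤ 5 * (C.dp + 1) * C.size ^ 3 := by
  induction hn : C.size using Nat.strong_induction_on generalizing C with
  | _ N ih =>
  subst hn
  obtain ⟨s, hsub, hsC, hirr⟩ := exists_irredundant_conjuncts C
  have hs : ∀ c ∈ s, IsConjunct SC SR c := fun c hc => isConjunct_of_mem_conjuncts hC (hsub hc)
  have hsum : ∑ c ∈ s, c.size ≤ C.size :=
    (Finset.sum_le_sum_of_subset hsub).trans (sum_conjuncts_size_le C)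
  have hsum' : ∑ c ∈ s, (c.size + 1) ≤ C.size + 1 :=
    (Finset.sum_le_sum_of_subset hsub).trans (sum_conjuncts_size_succ_le C)
  have hN := C.size_pos
  have hw : ∀ c ∈ s, ∃ w, IsConjunctFrontier SC SR c w ∧
      (w.map fun x => x.size + 1).sum + (C.size + 2) ≤
        5 * (C.dp + 1) * C.size ^ 2 * c.size := by
    intro c hc
    have hcN : c.size ≤ C.size :=
      (Finset.single_le_sum (f := Concept.size) (fun _ _ => Nat.zero_le _) hc).trans hsum
    have hcdp := dp_le_of_mem_conjuncts (hsub hc)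
    obtain ⟨A, hA, rfl⟩ | ⟨k, r, D, hk, hr, hD, rfl⟩ := hs c hc
    · refine ⟨[], isConjunctFrontier_atom SC SR A, ?_⟩
      simp only [List.map_nil, List.sum_nil, Concept.size]
      nlinarith [Nat.zero_le (C.dp * C.size ^ 2)]
    · simp only [Concept.size] at hcN
      simp only [Concept.dp] at hcdp
      obtain ⟨F, hF, hlen, hFsum⟩ := ih D.size (by omega) D hD rfl
      refine ⟨weakenings k r D F, isConjunctFrontier_weakenings hk hr hD hF, ?_⟩
      have hwsum := sum_size_weakenings_le k r D F
      have hDpos := D.size_pos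
      have hkpos : 1 ≤ Nat.size k := Nat.size_pos.2 hk
      simp only [Concept.size]
      generalize C.size = N at *
      generalize D.size = m at *
      generalize Nat.size k = z at *
      generalize hn : m + 2 + z = n at *
      have h1 : 5 * (D.dp + 1) * m ^ 3 ≤ 5 * C.dp * (N ^ 2 * n) := by
        refine Nat.mul_le_mul (Nat.mul_le_mul_left 5 hcdp) ?_
        rw [pow_succ]
        exact Nat.mul_le_mul (Nat.pow_le_pow_left (by omega) 2) (by omega)
      have h2 : F.length * (z + 3) ≤ N * n :=
        Nat.mul_le_mul (by omega) (by omega)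
      have h3 : N * n ≤ N ^ 2 * n :=
        Nat.mul_le_mul_right n (Nat.le_self_pow (by omega) N)
      have h4 : N + n + 3 ≤ 4 * (N * n) := by nlinarith
      have h5 : 5 * (C.dp + 1) * N ^ 2 * n = 5 * C.dp * (N ^ 2 * n) + 5 * (N ^ 2 * n) := by ring
      omega
  choose! w hwF hwsize using hw
  refine ⟨_, isFrontier_of_irredundant hs hsC hirr hwF, ?_, ?_⟩
  · rw [List.length_map, Finset.length_toList, Finset.card_eq_sum_ones]
    exact (Finset.sum_le_sum fun c _ => c.size_pos).trans hsum
  · rw [List.map_map, Finset.sum_map_toList]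
    calc ∑ c ∈ s, (bigAnd (w c ++ (s.erase c).toList)).size
        ≤ ∑ c ∈ s, 5 * (C.dp + 1) * C.size ^ 2 * c.size := by
          refine Finset.sum_le_sum fun c hc => ?_
          rw [size_bigAnd, List.map_append, List.sum_append, Finset.sum_map_toList]
          have h1 : ∑ x ∈ s.erase c, (x.size + 1) ≤ C.size + 1 :=
            (Finset.sum_le_sum_of_subset (Finset.erase_subset _ _)).trans hsum'
          have h2 := hwsize c hc
          omega
      _ = 5 * (C.dp + 1) * C.size ^ 2 * ∑ c ∈ s, c.size := by rw [Finset.mul_sum]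
      _ ≤ 5 * (C.dp + 1) * C.size ^ 2 * C.size := Nat.mul_le_mul_left _ hsum
      _ = 5 * (C.dp + 1) * C.size ^ 3 := by ring

/-- **Theorem (frontiers for `L(≥,⊓,⊤)`)**: every `C ∈ L(≥,⊓,⊤)[SC,SR]` has
a frontier w.r.t. `L(≥,⊓,⊤)[SC,SR]` of total size at most
`5 · (dp(C)+1) · |C|³`. -/
theorem ELQ_frontier (SC SR : Finset ℕ) (C : Concept)
    (hC : C.inLang ELQops SC SR) :
    ∃ F : List Concept,
      IsFrontier (Concept.inLang ELQops SC SR) C F ∧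
      (F.map Concept.size).sum ≤ 5 * (C.dp + 1) * C.size ^ 3 := by
  obtain ⟨F, hF, -, hsize⟩ := exists_frontier SC SR C hC
  exact ⟨F, hF, hsize⟩

end DL
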